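/- arXiv:q-alg/9603010 — 3 statements merged into one kernel-verified Lean document; each statement's English description precedes it below -/
import Mathlib

section
/- Let Γ be a trivalent Wilson graph with n external and t internal vertices which is NOT primitive, i.e. the graph Γ − W_Γ (all vertices, only non-Wilson edges) has connected components Γ_1,…,Γ_r with r ≥ 2. Choose c_1,…,c_r ∈ ℝ, not all zero, with Σ_α c_α · deg Γ_α = 0, where deg Γ_α is half the number of vertices of Γ_α. On S² × ℝⁿ × (ℝ³)^t with coordinates (a, η_1,…,η_n, ω_1,…,ω_t), define V_α = Σ_{i external in Γ_α} ∂/∂η_i + Σ_{j internal in Γ_α} ⟨a, ∂/∂ω_j⟩, the dilation field 𝒟 = Σ_i η_i ∂/∂η_i + Σ_j ⟨ω_j, ∂/∂ω_j⟩, the function λ(a,η,ω) = Σ_α c_α (Σ_{i external in Γ_α} η_i + Σ_{j internal in Γ_α} ⟨a, ω_j⟩), and the vector field V = Σ_α c_α V_α − λ𝒟. Then: (a) at every point of S_{n,t}, V is tangent to S_{n,t}; (b) the interior product ι_V Θ_Γ vanishes identically; and (c) V ≠ 0 outside a measure-zero subset of S_{n,t}. Consequently, at almost every point p ∈ S_{n,t},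 the restriction of the top-degree form Θ_Γ(p) to the (n+3t)-dimensional tangent space T_p S_{n,t} is zero (hence the anomaly coefficient f_Γ = ∫_{S_{n,t}} Θ_Γ vanishes for non-primitive Γ). -/
/- ## Core: labelled Wilson diagrams (trivalent or with one 4-valent vertex),
   encoded by an "anchor" equivalence between edge-slots and vertex/component
   coordinates.  External vertices are labelled `Fin n` cyclically along the
   oriented Wilson line, internal vertices by `Fin t`.  Only non-Wilson edges
   are recorded (Wilson edges are the implicit arcs between consecutive
   external labels).  The anchor encodes both the valences and a representative
   of the vertex orientation (V-orientation). -/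

noncomputable section

open scoped BigOperators

/-- slot-count of a trivalent Wilson graph: each external vertex carries one
non-Wilson edge-end, each internal vertex three. -/
def triBound (n t : ℕ) : Fin n ⊕ Fin t → ℕ := fun v =>
  match v with
  | .inl _ => 1
  | .inr _ => 3

/-- slot-count of a Wilson graph with a single 4-valent vertex `m`
(all other vertices trivalent). -/
def quadBound (n t : ℕ) (m : Fin n ⊕ Fin t) : Fin n ⊕ Fin t → ℕ := fun v =>
  if v = m then (match m with | .inl _ => 2 | .inr _ => 4) else triBound n t v

/-- A (V-oriented) Wilson diagram with `n` external and `t` internal vertices and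
slot-counts `bd`.  `anch` sends each end `(e, b)` of a non-Wilson edge `e` to the
vertex it is attached to, together with its position in the V-orientation order
of the non-Wilson edge-ends at that vertex. -/
structure BDiag (n t : ℕ) (bd : Fin n ⊕ Fin t → ℕ) where
  E : Type
  [fE : Fintype E]
  [dE : DecidableEq E]
  anch : E × Bool ≃ ((v : Fin n ⊕ Fin t) × Fin (bd v))
  npos : 0 < n
  /-- connectivity (through non-Wilson edges together with the Wilson line) -/
  conn : (SimpleGraph.fromRel (fun u v =>
      (∃ (e : E) (b : Bool), (anch (e, b)).1 = u ∧ (anch (e, !b)).1 = v) ∨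
      (∃ i j : Fin n, u = Sum.inl i ∧ v = Sum.inl j ∧ (i.val + 1) % n = j.val))).Connected

attribute [instance] BDiag.fE BDiag.dE

/-- the vertex at which the end `(e,b)` is attached. -/
def BDiag.ep {n t : ℕ} {bd : Fin n ⊕ Fin t → ℕ} (Γ : BDiag n t bd) (e : Γ.E) (b : Bool) :
    Fin n ⊕ Fin t := (Γ.anch (e, b)).1

/-- the V-orientation position of the end `(e,b)` at its vertex. -/
def BDiag.cmp {n t : ℕ} {bd : Fin n ⊕ Fin t → ℕ} (Γ : BDiag n t bd) (e : Γ.E) (b : Bool) :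
    ℕ := ((Γ.anch (e, b)).2 : ℕ)

/-- trivalent V-oriented Wilson diagrams. -/
abbrev Tri (n t : ℕ) := BDiag n t (triBound n t)

/-- relabelling of vertices by a rotation `k` of the Wilson line and a
permutation `π` of the internal vertices. -/
def vmap {n t : ℕ} (k : Fin n) (π : Equiv.Perm (Fin t)) :
    Fin n ⊕ Fin t → Fin n ⊕ Fin t := Sum.map (· + k) π

/-- Isomorphisms of (V-oriented) Wilson diagrams: a bijection `ψ` of edges with
end-flips `fl`, a rotation `k` of the Wilson line (preserving its orientation),
a permutation `π` of internal vertices, and for each vertex a permutation `ρ`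
of the local V-orientation orders. -/
structure BIso {n t : ℕ} {bd bd' : Fin n ⊕ Fin t → ℕ}
    (Γ : BDiag n t bd) (Γ' : BDiag n t bd') where
  ψ : Γ.E ≃ Γ'.E
  fl : Γ.E → Bool
  k : Fin n
  π : Equiv.Perm (Fin t)
  ρ : (v : Fin n ⊕ Fin t) → Fin (bd v) ≃ Fin (bd' (vmap k π v))
  hanch : ∀ (e : Γ.E) (b : Bool),
    Γ'.anch (ψ e, xor (fl e) b) =
      ⟨vmap k π (Γ.anch (e, b)).1, ρ (Γ.anch (e, b)).1 (Γ.anch (e, b)).2⟩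

/-- the sign comparing the V-orientation of the target with the V-orientation
induced by the isomorphism (product over all vertices of the signatures of the
local reorderings). -/
noncomputable def BIso.sign {n t : ℕ} {bd bd' : Fin n ⊕ Fin t → ℕ}
    {Γ : BDiag n t bd} {Γ' : BDiag n t bd'} (φ : BIso Γ Γ') : ℤˣ :=
  ∏ v : Fin n ⊕ Fin t, Equiv.Perm.sign ((φ.ρ v).trans (finCongr (by
    simpa using (Fintype.card_congr (φ.ρ v)).symm)))

/-- Automorphisms of the underlying Wilson graph (forgetting V-orientations):
pairs `(ρ, σ)` of a vertex bijection preserving the oriented Wilson line and an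
edge bijection intertwining the boundary maps. -/
structure GAuto {n t : ℕ} {bd : Fin n ⊕ Fin t → ℕ} (Γ : BDiag n t bd) where
  ψ : Equiv.Perm Γ.E
  k : Fin n
  π : Equiv.Perm (Fin t)
  hep : ∀ e : Γ.E,
    (Γ.ep (ψ e) false = vmap k π (Γ.ep e false) ∧ Γ.ep (ψ e) true = vmap k π (Γ.ep e true)) ∨
    (Γ.ep (ψ e) false = vmap k π (Γ.ep e true) ∧ Γ.ep (ψ e) true = vmap k π (Γ.ep e false))

/-- Isomorphisms of the underlying Wilson graphs (not respecting V-orientation). -/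
structure UIso {n t : ℕ} {bd bd' : Fin n ⊕ Fin t → ℕ}
    (Γ : BDiag n t bd) (Γ' : BDiag n t bd') where
  ψ : Γ.E ≃ Γ'.E
  fl : Γ.E → Bool
  k : Fin n
  π : Equiv.Perm (Fin t)
  hep : ∀ (e : Γ.E) (b : Bool), Γ'.ep (ψ e) (xor (fl e) b) = vmap k π (Γ.ep e b)

/-- the interior of a Wilson diagram, as a simple graph on its vertices
(adjacency through non-Wilson edges only). -/
def intG {n t : ℕ} {bd : Fin n ⊕ Fin t → ℕ} (Γ : BDiag n t bd) :
    SimpleGraph (Fin n ⊕ Fin t) :=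
  SimpleGraph.fromRel (fun u v => ∃ (e : Γ.E) (b : Bool), Γ.ep e b = u ∧ Γ.ep e (!b) = v)

end
/- ## Feynman rules: configuration-space integrals of trivalent Wilson diagrams.
   The wedge of the pulled-back Gauss forms, evaluated against the orientation
   `Ω(Γ, or_Γ)` determined by the anchor (V-orientation), is expanded by the
   standard alternating-sum formula over all bijections from edge-ends to
   configuration coordinates. -/

noncomputable section

open scoped BigOperators

abbrev V3 := Fin 3 → ℝ

def dot3 (a b : V3) : ℝ := a 0 * b 0 + a 1 * b 1 + a 2 * b 2

def cross3 (a b : V3) : V3 :=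
  ![a 1 * b 2 - a 2 * b 1, a 2 * b 0 - a 0 * b 2, a 0 * b 1 - a 1 * b 0]

/-- the pullback `u^*ω` of the Gauss two-form on `S²` under `u(x) = x/|x|`,
as a bilinear form at the point `x`:  `(1/4π) ⟨x, a × b⟩ / |x|³`. -/
def gauss2 (x a b : V3) : ℝ :=
  dot3 x (cross3 a b) / (4 * Real.pi * (Real.sqrt (dot3 x x)) ^ 3)

/-- a smooth embedding `S¹ → ℝ³`, modelled as a 1-periodic smooth immersion of
`ℝ` injective on a period. -/
structure Knot where
  map : ℝ → V3
  smooth : ContDiff ℝ (⊤ : ℕ∞) map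
  periodic : Function.Periodic map 1
  injOn : Set.InjOn map (Set.Ico 0 1)
  immersed : ∀ s : ℝ, deriv map s ≠ 0

/-- the configuration space `C_{n,t}(φ)` of `n` cyclically ordered points on the
knot and `t` pairwise distinct points of `ℝ³` off the knot (the circle
parameters are lifted to a fundamental domain). -/
def Config (φ : Knot) (n t : ℕ) : Set ((Fin n → ℝ) × (Fin t → V3)) :=
  {c | StrictMono c.1 ∧ (∀ i j : Fin n, c.1 i < c.1 j + 1) ∧
       (∀ i : Fin n, 0 ≤ c.1 i) ∧ (n ≠ 0 → ∃ i0 : Fin n, c.1 i0 < 1) ∧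
       Function.Injective c.2 ∧
       (∀ (i : Fin n) (j : Fin t), φ.map (c.1 i) ≠ c.2 j)}

/-- the position in `ℝ³` of a vertex of the diagram, at a given configuration. -/
def posOf (φ : Knot) {n t : ℕ} (c : (Fin n → ℝ) × (Fin t → V3)) :
    Fin n ⊕ Fin t → V3
  | .inl i => φ.map (c.1 i)
  | .inr j => c.2 j

/-- the derivative of the position of a vertex in the direction of a tangent
vector `w` of the configuration space. -/
def dposOf (φ : Knot) {n t : ℕ} (c w : (Fin n → ℝ) × (Fin t → V3)) :
    Fin n ⊕ Fin t → V3
  | .inl i => w.1 i • deriv φ.map (c.1 i)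
  | .inr j => w.2 j

/-- the standard basis tangent vector of the configuration space attached to the
coordinate `⟨v, c⟩` (the circle parameter of an external vertex, or one of the
three space coordinates of an internal vertex). -/
def bvec {n t : ℕ} : ((v : Fin n ⊕ Fin t) × Fin (triBound n t v)) →
    (Fin n → ℝ) × (Fin t → V3)
  | ⟨.inl i, _⟩ => (Pi.single i 1, 0)
  | ⟨.inr j, c⟩ => (0, Pi.single j (Pi.single c (1 : ℝ)))

/-- the integrand of `I(Γ)(φ)`: the wedge `⋀_e φ_e^* ω` of the pulled-back Gauss
forms over all non-Wilson edges, evaluated on the standard coordinate frame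
ordered by the orientation `Ω(Γ, or_Γ)` (the sum runs over all bijections
between edge-ends and configuration coordinates, with the sign relative to the
anchor of `Γ`). -/
def integrand {n t : ℕ} (Γ : Tri n t) (φ : Knot)
    (c : (Fin n → ℝ) × (Fin t → V3)) : ℝ :=
  ∑ τ : (Γ.E × Bool) ≃ ((v : Fin n ⊕ Fin t) × Fin (triBound n t v)),
    ((Equiv.Perm.sign (τ.trans Γ.anch.symm) : ℤ) : ℝ) *
      ∏ e : Γ.E,
        gauss2 (posOf φ c (Γ.ep e true) - posOf φ c (Γ.ep e false))
          (dposOf φ c (bvec (τ (e, false))) (Γ.ep e true) -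
            dposOf φ c (bvec (τ (e, false))) (Γ.ep e false))
          (dposOf φ c (bvec (τ (e, true))) (Γ.ep e true) -
            dposOf φ c (bvec (τ (e, true))) (Γ.ep e false))

/-- the configuration-space integral `I(Γ)(φ)`. -/
def Itri {n t : ℕ} (Γ : Tri n t) (φ : Knot) : ℝ :=
  ∫ c in Config φ n t, integrand Γ φ c

end
/- ## The anomaly:  the variety `S_{n,t}` and the form `Θ_Γ`. -/

noncomputable section

open scoped BigOperators

/-- the ambient space `S² × ℝⁿ × (ℝ³)^t` (with the sphere realized as the unit
sphere of the first `ℝ³` factor). -/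
abbrev WS (n t : ℕ) := V3 × (Fin n → ℝ) × (Fin t → V3)

/-- the variety `S_{n,t}` of (26) in Altschuler-Freidel. -/
def Snt (n t : ℕ) : Set (WS n t) :=
  {p | dot3 p.1 p.1 = 1 ∧
       (∃ k : Fin n, StrictMono (fun i : Fin n => p.2.1 (i + k))) ∧
       Function.Injective p.2.2 ∧
       (∀ (i : Fin n) (j : Fin t), (p.2.1 i) • p.1 ≠ p.2.2 j) ∧
       ((∑ i : Fin n, (p.2.1 i) ^ 2) + ∑ j : Fin t, dot3 (p.2.2 j) (p.2.2 j) = 1) ∧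
       ((∑ i : Fin n, p.2.1 i) + ∑ j : Fin t, dot3 (p.2.2 j) p.1 = 0)}

/-- position of a vertex: external vertices sit on the line `ℝ·a` at `η_i • a`,
internal vertices at `ω_j`. -/
def posS {n t : ℕ} (p : WS n t) : Fin n ⊕ Fin t → V3
  | .inl i => (p.2.1 i) • p.1
  | .inr j => p.2.2 j

/-- derivative of the position in the direction of an ambient tangent vector. -/
def dposS {n t : ℕ} (p w : WS n t) : Fin n ⊕ Fin t → V3
  | .inl i => (w.2.1 i) • p.1 + (p.2.1 i) • w.1
  | .inr j => w.2.2 j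

/-- the set where all the maps `φ_e` (hence `Θ_Γ`) are defined. -/
def UTheta {n t : ℕ} (Γ : Tri n t) : Set (WS n t) :=
  {p | ∀ e : Γ.E, posS p (Γ.ep e true) ≠ posS p (Γ.ep e false)}

/-- the `(n+3t)`-form `Θ_Γ = ⋀_e φ_e^* ω`, evaluated on a family of ambient
vectors indexed by the `n + 3t` coordinates of `S_{n,t}` (sum over all
bijections of edge-ends with coordinates, with signs relative to the anchor). -/
def ThetaEval {n t : ℕ} (Γ : Tri n t) (p : WS n t)
    (v : ((u : Fin n ⊕ Fin t) × Fin (triBound n t u)) → WS n t) : ℝ :=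
  ∑ τ : (Γ.E × Bool) ≃ ((u : Fin n ⊕ Fin t) × Fin (triBound n t u)),
    ((Equiv.Perm.sign (τ.trans Γ.anch.symm) : ℤ) : ℝ) *
      ∏ e : Γ.E,
        gauss2 (posS p (Γ.ep e true) - posS p (Γ.ep e false))
          (dposS p (v (τ (e, false))) (Γ.ep e true) -
            dposS p (v (τ (e, false))) (Γ.ep e false))
          (dposS p (v (τ (e, true))) (Γ.ep e true) -
            dposS p (v (τ (e, true))) (Γ.ep e false))

/-- the tangent space of `S_{n,t}` at `p` (kernel of the differentials of the
defining constraints). -/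
def TangS {n t : ℕ} (p w : WS n t) : Prop :=
  dot3 p.1 w.1 = 0 ∧
  ((∑ i : Fin n, p.2.1 i * w.2.1 i) + ∑ j : Fin t, dot3 (p.2.2 j) (w.2.2 j)) = 0 ∧
  ((∑ i : Fin n, w.2.1 i) +
    ∑ j : Fin t, (dot3 (w.2.2 j) p.1 + dot3 (p.2.2 j) w.1)) = 0

end
/- STATEMENT 14: vanishing of the anomaly for non-primitive graphs. -/

noncomputable section

open scoped BigOperators

/-- the function `λ` of Altschuler-Freidel (section 5), for a choice of
coefficients `c_α` indexed by the connected components of the interior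
`Γ - W_Γ`. -/
def lamF {n t : ℕ} (Γ : Tri n t) (c : (intG Γ).ConnectedComponent → ℝ)
    (p : WS n t) : ℝ :=
  (∑ i : Fin n, c ((intG Γ).connectedComponentMk (Sum.inl i)) * p.2.1 i) +
  ∑ j : Fin t, c ((intG Γ).connectedComponentMk (Sum.inr j)) * dot3 p.1 (p.2.2 j)

/-- the vector field `V = Σ_α c_α V_α - λ·𝒟` (written componentwise: at each
vertex, the translation field of its component minus `λ` times the dilation
field; it has no `a`-component). -/
def Vfield {n t : ℕ} (Γ : Tri n t) (c : (intG Γ).ConnectedComponent → ℝ)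
    (p : WS n t) : WS n t :=
  (0,
   fun i => c ((intG Γ).connectedComponentMk (Sum.inl i)) - lamF Γ c p * p.2.1 i,
   fun j => c ((intG Γ).connectedComponentMk (Sum.inr j)) • p.1 - lamF Γ c p • p.2.2 j)

/-- The Gauss two-form at `x` as a bilinear map. -/
def gaussBilin (x : V3) : V3 →ₗ[ℝ] V3 →ₗ[ℝ] ℝ :=
  LinearMap.mk₂ ℝ (gauss2 x)
    (fun a a' b => by simp [gauss2, dot3, cross3]; ring)
    (fun r a b => by simp [gauss2, dot3, cross3]; ring)
    (fun a b b' => by simp [gauss2, dot3, cross3]; ring)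
    (fun r a b => by simp [gauss2, dot3, cross3]; ring)

theorem gauss2_smul_self_left (x b : V3) (r : ℝ) : gauss2 x (r • x) b = 0 := by
  simp only [gauss2, dot3, cross3, Pi.smul_apply, smul_eq_mul, Matrix.cons_val]
  ring

theorem gauss2_smul_self_right (x a : V3) (r : ℝ) : gauss2 x a (r • x) = 0 := by
  simp only [gauss2, dot3, cross3, Pi.smul_apply, smul_eq_mul, Matrix.cons_val]
  ring

/-- The differential of the position of a vertex as a linear map. -/
def dposLin {n t : ℕ} (p : WS n t) (u : Fin n ⊕ Fin t) : WS n t →ₗ[ℝ] V3 where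
  toFun w := dposS p w u
  map_add' w w' := by
    cases u
    · ext k
      simp [dposS]
      ring
    · simp [dposS]
  map_smul' r w := by
    cases u
    · ext k
      simp [dposS]
      ring
    · simp [dposS]

theorem prod_erase_update {E M : Type*} [Fintype E] [DecidableEq E] [AddCommGroup M] [Module ℝ M]
    [DecidableEq (E × Bool)] (B : E → M →ₗ[ℝ] M →ₗ[ℝ] ℝ) (w : E × Bool → M) (e₀ : E) (b : Bool)
    (z : M) :
    ∏ e ∈ Finset.univ.erase e₀, B e (Function.update w (e₀, b) z (e, false))
        (Function.update w (e₀, b) z (e, true)) =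
      ∏ e ∈ Finset.univ.erase e₀, B e (w (e, false)) (w (e, true)) :=
  Finset.prod_congr rfl fun e he => by
    rw [Function.update_of_ne, Function.update_of_ne] <;> simp [Finset.ne_of_mem_erase he]

/-- The product of a family of bilinear forms, as a multilinear map in all the arguments. -/
def bilinProd {E M : Type*} [Fintype E] [AddCommGroup M] [Module ℝ M]
    (B : E → M →ₗ[ℝ] M →ₗ[ℝ] ℝ) : MultilinearMap ℝ (fun _ : E × Bool => M) ℝ where
  toFun w := ∏ e, B e (w (e, false)) (w (e, true))
  map_update_add' w i x y := by
    classical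
    obtain ⟨e₀, b⟩ := i
    simp only [← Finset.mul_prod_erase Finset.univ _ (Finset.mem_univ e₀)]
    have rest := prod_erase_update B w e₀ b
    cases b <;> simp [Function.update_apply] at rest ⊢ <;> simp [rest, add_mul]
  map_update_smul' w i r x := by
    classical
    obtain ⟨e₀, b⟩ := i
    simp only [← Finset.mul_prod_erase Finset.univ _ (Finset.mem_univ e₀)]
    have rest := prod_erase_update B w e₀ b
    cases b <;> simp [Function.update_apply] at rest ⊢ <;> simp [rest, mul_assoc]

/-- The form `Θ_Γ` at `p` as an alternating map in vectors indexed by the edge-ends. -/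
def thetaAlt {n t : ℕ} (Γ : Tri n t) (p : WS n t) : WS n t [⋀^Γ.E × Bool]→ₗ[ℝ] ℝ :=
  MultilinearMap.alternatization (bilinProd fun e : Γ.E =>
    (gaussBilin (posS p (Γ.ep e true) - posS p (Γ.ep e false))).compl₁₂
      (dposLin p (Γ.ep e true) - dposLin p (Γ.ep e false))
      (dposLin p (Γ.ep e true) - dposLin p (Γ.ep e false)))

theorem thetaEval_eq_thetaAlt {n t : ℕ} (Γ : Tri n t) (p : WS n t)
    (v : ((u : Fin n ⊕ Fin t) × Fin (triBound n t u)) → WS n t) :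
    ThetaEval Γ p v = thetaAlt Γ p (v ∘ Γ.anch) := by
  rw [thetaAlt, MultilinearMap.alternatization_apply, ThetaEval]
  refine Fintype.sum_equiv (Equiv.equivCongr (Equiv.refl _) Γ.anch.symm) _ _ fun τ => ?_
  simp only [MultilinearMap.domDomCongr_apply, Units.smul_def, zsmul_eq_mul]
  congr 1
  refine Finset.prod_congr rfl fun e _ => ?_
  simp only [Equiv.equivCongr, Equiv.coe_fn_mk, Equiv.refl_symm, Equiv.refl_trans,
    Equiv.trans_apply, Function.comp_apply, Equiv.apply_symm_apply]
  rfl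

/-- An alternating map in at least as many vectors as the dimension vanishes as soon as it vanishes
when one of its arguments is some fixed nonzero vector. -/
theorem AlternatingMap.eq_zero_of_finrank_le {ι M : Type*} [Fintype ι] [DecidableEq ι]
    [AddCommGroup M] [Module ℝ M] [FiniteDimensional ℝ M] (A : M [⋀^ι]→ₗ[ℝ] ℝ)
    (hdim : Module.finrank ℝ M ≤ Fintype.card ι) {x : M} (hx : x ≠ 0)
    (hA : ∀ (v : ι → M) (i : ι), v i = x → A v = 0) (v : ι → M) : A v = 0 := by
  by_cases hv : LinearIndependent ℝ v
  · have hspan : Submodule.span ℝ (Set.range v) = ⊤ :=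
      hv.span_eq_top_of_card_eq_finrank' (le_antisymm hv.fintype_card_le_finrank hdim)
    obtain ⟨a, ha⟩ := (Submodule.mem_span_range_iff_exists_fun ℝ).1
      (hspan ▸ Submodule.mem_top : x ∈ Submodule.span ℝ (Set.range v))
    obtain ⟨k, hk⟩ : ∃ k, a k ≠ 0 := by
      by_contra! h
      exact hx (by simp [← ha, h])
    have h0 : A (Function.update v k (∑ i, a i • v i)) = 0 := hA _ k (by simp [ha])
    rw [A.map_update_sum, Finset.sum_eq_single k] at h0
    · simpa [hk] using h0
    · intro i _ hik
      rw [A.map_update_smul, A.map_update_self v hik.symm, smul_zero]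
    · simp
  · exact A.map_linearDependent v hv

/-- The differentials of the constraints that define `S_{n,t}`. -/
def constraintLin {n t : ℕ} (p : WS n t) : WS n t →ₗ[ℝ] ℝ × ℝ × ℝ where
  toFun w := (dot3 p.1 w.1,
    (∑ i : Fin n, p.2.1 i * w.2.1 i) + ∑ j : Fin t, dot3 (p.2.2 j) (w.2.2 j),
    (∑ i : Fin n, w.2.1 i) + ∑ j : Fin t, (dot3 (w.2.2 j) p.1 + dot3 (p.2.2 j) w.1))
  map_add' w w' := by
    simp only [dot3, Prod.fst_add, Prod.snd_add, Pi.add_apply, Prod.mk_add_mk, mul_add, add_mul,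
      Finset.sum_add_distrib]
    refine Prod.ext ?_ (Prod.ext ?_ ?_) <;> dsimp only <;> ring
  map_smul' r w := by
    simp only [dot3, Prod.smul_fst, Prod.smul_snd, Pi.smul_apply, smul_eq_mul, Prod.smul_mk,
      RingHom.id_apply, mul_add, Finset.mul_sum, Finset.sum_add_distrib]
    refine Prod.ext ?_ (Prod.ext ?_ ?_) <;> dsimp only <;>
      simp only [mul_left_comm, mul_assoc]

theorem tangS_iff_mem_ker {n t : ℕ} (p w : WS n t) :
    TangS p w ↔ w ∈ LinearMap.ker (constraintLin p) := by
  simp [TangS, constraintLin]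

theorem dot3_zero_left (a : V3) : dot3 0 a = 0 := by
  simp [dot3]

theorem dot3_zero_right (a : V3) : dot3 a 0 = 0 := by
  simp [dot3]

theorem dot3_comm (a b : V3) : dot3 a b = dot3 b a := by
  simp only [dot3]; ring

theorem constraintLin_surjective {n t : ℕ} (hn : 0 < n) {p : WS n t} (hp : p ∈ Snt n t) :
    Function.Surjective (constraintLin p) := by
  obtain ⟨ha, -, -, -, hnorm, hcenter⟩ := hp
  have hnt : (n : ℝ) + t ≠ 0 := by positivity
  set s := ∑ j : Fin t, dot3 (p.2.2 j) p.1 with hs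
  have h₁ : constraintLin p (p.1, 0, 0) = (1, 0, s) := by
    simp [constraintLin, ha, hs, dot3_zero_left, dot3_zero_right]
  have h₂ : constraintLin p (0, p.2) = (0, 1, 0) := by
    simp only [constraintLin, LinearMap.coe_mk, AddHom.coe_mk]
    refine Prod.ext (by simp [dot3]) (Prod.ext ?_ ?_)
    · simpa [sq] using hnorm
    · simpa [dot3_zero_right] using hcenter
  have h₃ : constraintLin p (0, 1, fun _ => p.1) = (0, 0, (n : ℝ) + t) := by
    simp only [constraintLin, LinearMap.coe_mk, AddHom.coe_mk, ha]
    refine Prod.ext (by simp [dot3]) (Prod.ext ?_ ?_)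
    · simpa using hcenter
    · simp [dot3_zero_right]
  rintro ⟨x, y, z⟩
  refine ⟨x • (p.1, 0, 0) + y • (0, p.2) + ((z - x * s) / (n + t)) • (0, 1, fun _ => p.1), ?_⟩
  rw [map_add, map_add, map_smul, map_smul, map_smul, h₁, h₂, h₃]
  refine Prod.ext (by simp) (Prod.ext (by simp) ?_)
  simp
  field_simp
  ring

theorem finrank_ker_constraintLin {n t : ℕ} (hn : 0 < n) {p : WS n t} (hp : p ∈ Snt n t) :
    Module.finrank ℝ (LinearMap.ker (constraintLin p)) = n + 3 * t := by
  have h := (constraintLin p).finrank_range_add_finrank_ker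
  rw [LinearMap.range_eq_top.2 (constraintLin_surjective hn hp), finrank_top] at h
  simp only [Module.finrank_prod, Module.finrank_self, Module.finrank_fintype_fun_eq_card,
    Fintype.card_fin, Module.finrank_pi_fintype, Finset.sum_const, Finset.card_univ,
    smul_eq_mul] at h
  lia

theorem card_edgeEnds {n t : ℕ} (Γ : Tri n t) : Fintype.card (Γ.E × Bool) = n + 3 * t := by
  rw [Fintype.card_congr Γ.anch]
  simp only [Fintype.card_sigma, Fintype.card_fin, Fintype.sum_sum_type]
  simp [triBound, mul_comm]

theorem connectedComponentMk_ep {n t : ℕ} (Γ : Tri n t) (e : Γ.E) (b b' : Bool) :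
    (intG Γ).connectedComponentMk (Γ.ep e b) = (intG Γ).connectedComponentMk (Γ.ep e b') := by
  by_cases h : Γ.ep e b = Γ.ep e b'
  · rw [h]
  · have hb : b' = !b := by
      cases b <;> cases b' <;> simp_all
    refine SimpleGraph.ConnectedComponent.sound (SimpleGraph.Adj.reachable ?_)
    rw [intG, SimpleGraph.fromRel_adj]
    exact ⟨h, Or.inl ⟨e, b, rfl, by rw [hb]⟩⟩

theorem dposS_Vfield {n t : ℕ} (Γ : Tri n t) (c : (intG Γ).ConnectedComponent → ℝ)
    (p : WS n t) (u : Fin n ⊕ Fin t) :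
    dposS p (Vfield Γ c p) u =
      c ((intG Γ).connectedComponentMk u) • p.1 - lamF Γ c p • posS p u := by
  cases u <;> simp [dposS, Vfield, posS, sub_smul, mul_smul]

theorem dposS_Vfield_edge {n t : ℕ} (Γ : Tri n t) (c : (intG Γ).ConnectedComponent → ℝ)
    (p : WS n t) (e : Γ.E) :
    dposS p (Vfield Γ c p) (Γ.ep e true) - dposS p (Vfield Γ c p) (Γ.ep e false) =
      (-lamF Γ c p) • (posS p (Γ.ep e true) - posS p (Γ.ep e false)) := by
  rw [dposS_Vfield, dposS_Vfield, connectedComponentMk_ep Γ e true false]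
  module

theorem thetaEval_eq_zero_of_apply_eq_Vfield {n t : ℕ} (Γ : Tri n t)
    (c : (intG Γ).ConnectedComponent → ℝ) (p : WS n t)
    (v : ((u : Fin n ⊕ Fin t) × Fin (triBound n t u)) → WS n t)
    (γ₀ : (u : Fin n ⊕ Fin t) × Fin (triBound n t u)) (hv : v γ₀ = Vfield Γ c p) :
    ThetaEval Γ p v = 0 := by
  refine Finset.sum_eq_zero fun τ _ => ?_
  obtain ⟨⟨e, b⟩, rfl⟩ := τ.surjective γ₀
  refine mul_eq_zero_of_right _ (Finset.prod_eq_zero (Finset.mem_univ e) ?_)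
  cases b
  · rw [hv, dposS_Vfield_edge, gauss2_smul_self_left]
  · rw [hv, dposS_Vfield_edge, gauss2_smul_self_right]

theorem tangS_Vfield {n t : ℕ} (Γ : Tri n t) (c : (intG Γ).ConnectedComponent → ℝ)
    (hcdeg : ∑ v : Fin n ⊕ Fin t, c ((intG Γ).connectedComponentMk v) = 0)
    {p : WS n t} (hp : p ∈ Snt n t) : TangS p (Vfield Γ c p) := by
  obtain ⟨ha, -, -, -, hnorm, hcenter⟩ := hp
  rw [Fintype.sum_sum_type] at hcdeg
  have dot_right : ∀ (r s : ℝ) (x y z : V3),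
      dot3 x (r • y - s • z) = r * dot3 x y - s * dot3 x z := fun r s x y z => by
    simp only [dot3, Pi.sub_apply, Pi.smul_apply, smul_eq_mul]; ring
  have dot_left : ∀ (r s : ℝ) (x y z : V3),
      dot3 (r • y - s • z) x = r * dot3 y x - s * dot3 z x := fun r s x y z => by
    rw [dot3_comm, dot_right, dot3_comm x y, dot3_comm x z]
  refine ⟨dot3_zero_right _, ?_, ?_⟩
  · have hlam : (∑ i : Fin n, c ((intG Γ).connectedComponentMk (Sum.inl i)) * p.2.1 i) +
        ∑ j : Fin t, c ((intG Γ).connectedComponentMk (Sum.inr j)) * dot3 (p.2.2 j) p.1 =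
        lamF Γ c p := by
      simp only [lamF, dot3_comm p.1]
    simp only [Vfield, dot_right, mul_sub, Finset.sum_sub_distrib, mul_left_comm _ (lamF Γ c p),
      ← Finset.mul_sum, ← sq]
    simp only [mul_comm (p.2.1 _)]
    linear_combination hlam - lamF Γ c p * hnorm
  · simp only [Vfield, dot_left, dot3_zero_right, ha, mul_one, add_zero, Finset.sum_sub_distrib,
      ← Finset.mul_sum]
    linear_combination hcdeg - lamF Γ c p * hcenter

theorem posS_injective {n t : ℕ} {p : WS n t} (hp : p ∈ Snt n t) :
    Function.Injective (posS p) := by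
  obtain ⟨ha, ⟨k, hk⟩, hinj, hne, -, -⟩ := hp
  have hp1 : p.1 ≠ 0 := by
    intro h
    simp [h, dot3] at ha
  have : NeZero n := ⟨by rintro rfl; exact k.elim0⟩
  have hη : Function.Injective p.2.1 := fun i j hij => by
    have h : i - k = j - k := hk.injective (by simpa using hij)
    simpa using h
  rintro (i | i) (j | j) h
  · exact congrArg _ (hη (smul_left_injective ℝ hp1 h))
  · exact absurd h (hne i j)
  · exact absurd h.symm (hne j i)
  · exact congrArg _ (hinj h)

theorem exists_ep_ne {n t : ℕ} (Γ : Tri n t) : ∃ e : Γ.E, Γ.ep e true ≠ Γ.ep e false := by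
  obtain ⟨⟨e, b⟩, hx⟩ := Γ.anch.surjective ⟨Sum.inl ⟨0, Γ.npos⟩, (0 : Fin 1)⟩
  refine ⟨e, fun h => ?_⟩
  have hb : ∀ b', (Γ.anch (e, b')).1 = Sum.inl ⟨0, Γ.npos⟩ := by
    have := congrArg Sigma.fst hx
    cases b <;> rintro (_ | _) <;> simp_all [BDiag.ep]
  have heq : ∀ y z : (u : Fin n ⊕ Fin t) × Fin (triBound n t u),
      y.1 = Sum.inl ⟨0, Γ.npos⟩ → z.1 = Sum.inl ⟨0, Γ.npos⟩ → y = z := by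
    rintro ⟨_, y⟩ ⟨_, z⟩ rfl hz
    dsimp only at hz
    subst hz
    exact congrArg _ (Subsingleton.elim (α := Fin 1) y z)
  simpa using Γ.anch.injective (heq _ _ (hb true) (hb false))

theorem Vfield_ne_zero {n t : ℕ} (Γ : Tri n t) (c : (intG Γ).ConnectedComponent → ℝ)
    (hc0 : ∃ v : Fin n ⊕ Fin t, c ((intG Γ).connectedComponentMk v) ≠ 0)
    {p : WS n t} (hp : p ∈ Snt n t) : Vfield Γ c p ≠ 0 := by
  intro hV
  have hpos : ∀ u, c ((intG Γ).connectedComponentMk u) • p.1 = lamF Γ c p • posS p u := fun u => by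
    rw [← sub_eq_zero, ← dposS_Vfield, hV]
    exact map_zero (dposLin p u)
  have hlam : lamF Γ c p ≠ 0 := by
    intro h
    obtain ⟨u, hu⟩ := hc0
    have h1 := hpos u
    rw [h, zero_smul, smul_eq_zero, or_iff_right hu] at h1
    have ha := hp.1
    simp [h1, dot3] at ha
  obtain ⟨e, he⟩ := exists_ep_ne Γ
  refine he (posS_injective hp (smul_right_injective V3 hlam ?_))
  simp only [← hpos, connectedComponentMk_ep Γ e true false]

theorem thetaEval_eq_zero_of_tangS {n t : ℕ} (Γ : Tri n t)
    (c : (intG Γ).ConnectedComponent → ℝ)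
    (hc0 : ∃ v : Fin n ⊕ Fin t, c ((intG Γ).connectedComponentMk v) ≠ 0)
    (hcdeg : ∑ v : Fin n ⊕ Fin t, c ((intG Γ).connectedComponentMk v) = 0)
    {p : WS n t} (hp : p ∈ Snt n t)
    (v : ((u : Fin n ⊕ Fin t) × Fin (triBound n t u)) → WS n t) (hv : ∀ γ, TangS p (v γ)) :
    ThetaEval Γ p v = 0 := by
  let T := LinearMap.ker (constraintLin p)
  let x : T := ⟨Vfield Γ c p, (tangS_iff_mem_ker p _).1 (tangS_Vfield Γ c hcdeg hp)⟩
  have hx : x ≠ 0 := fun h => Vfield_ne_zero Γ c hc0 hp (congrArg Subtype.val h)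
  have key := AlternatingMap.eq_zero_of_finrank_le ((thetaAlt Γ p).compLinearMap T.subtype)
    (by rw [finrank_ker_constraintLin Γ.npos hp, card_edgeEnds]) hx
    (fun w i hw => by
      have h := thetaEval_eq_zero_of_apply_eq_Vfield Γ c p
        (fun γ => (w (Γ.anch.symm γ) : WS n t)) (Γ.anch i) (by simp [hw, x])
      rw [thetaEval_eq_thetaAlt] at h
      simpa [Function.comp_def] using h)
    (fun i => ⟨v (Γ.anch i), (tangS_iff_mem_ker p _).1 (hv _)⟩)
  rw [thetaEval_eq_thetaAlt]
  exact key

/- Let `Γ` be a trivalent Wilson graph which is NOT primitive (its interior is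
disconnected), and choose coefficients `c_α` on the components, not all zero,
with `Σ_α c_α · deg Γ_α = 0` (equivalently `Σ_v c_{[v]} = 0`).  Then:
(a) `V` is tangent to `S_{n,t}`;
(b) `ι_V Θ_Γ = 0` (i.e. `Θ_Γ` vanishes whenever `V` is one of its arguments);
(c) `V ≠ 0` off a set of `(n+3t)`-dimensional Hausdorff measure zero in
`S_{n,t}`; consequently at almost every point of `S_{n,t}` the restriction of
`Θ_Γ` to the tangent space of `S_{n,t}` vanishes (whence `f_Γ = 0`). -/
theorem anomaly_vanishes_nonprimitive (n t : ℕ) (Γ : Tri n t)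
    (hnp : ¬ (intG Γ).Preconnected)
    (c : (intG Γ).ConnectedComponent → ℝ)
    (hc0 : ∃ v : Fin n ⊕ Fin t, c ((intG Γ).connectedComponentMk v) ≠ 0)
    (hcdeg : ∑ v : Fin n ⊕ Fin t, c ((intG Γ).connectedComponentMk v) = 0) :
    (∀ p ∈ Snt n t, TangS p (Vfield Γ c p)) ∧
    (∀ p ∈ UTheta Γ,
      ∀ (v : ((u : Fin n ⊕ Fin t) × Fin (triBound n t u)) → WS n t)
        (γ0 : (u : Fin n ⊕ Fin t) × Fin (triBound n t u)),
        v γ0 = Vfield Γ c p → ThetaEval Γ p v = 0) ∧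
    (MeasureTheory.Measure.hausdorffMeasure ((n : ℝ) + 3 * t)
      {p : WS n t | p ∈ Snt n t ∧ Vfield Γ c p = 0} = 0) ∧
    (MeasureTheory.Measure.hausdorffMeasure ((n : ℝ) + 3 * t)
      {p : WS n t | p ∈ Snt n t ∧
        ¬ (∀ v : ((u : Fin n ⊕ Fin t) × Fin (triBound n t u)) → WS n t,
            (∀ γ, TangS p (v γ)) → ThetaEval Γ p v = 0)} = 0) := by
  refine ⟨fun p hp => tangS_Vfield Γ c hcdeg hp,
    fun p _ v γ₀ hv => thetaEval_eq_zero_of_apply_eq_Vfield Γ c p v γ₀ hv, ?_, ?_⟩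
  · refine (congrArg _ (Set.eq_empty_of_forall_notMem ?_)).trans MeasureTheory.measure_empty
    exact fun p hp => Vfield_ne_zero Γ c hc0 hp.1 hp.2
  · refine (congrArg _ (Set.eq_empty_of_forall_notMem ?_)).trans MeasureTheory.measure_empty
    exact fun p hp =>
      hp.2 fun v hv => thetaEval_eq_zero_of_tangS Γ c hc0 hcdeg hp.1 v hv

end
end

section
/- Let Γ be a trivalent Wilson graph with n external and t internal vertices and an orientation of its non-Wilson edges, and let Θ_Γ = ∧_{e non-Wilson} φ_e*ω be the corresponding (n+3t)-form, defined on the open set U of points (a,η,ω) ∈ (ℝ³∖{0}) × ℝⁿ × (ℝ³)^t where all the maps φ_e are defined. Let S be the linear involution S(a, η_1,…,η_n, ω_1,…,ω_t) = (−a, η_1,…,η_n, −ω_1,…,−ω_t). Then: (a) S(U) = U and S maps S_{n,t} onto itself; (b) the pullback satisfies S*Θ_Γ = (−1)^{(n+3t)/2} · Θ_Γ on U, i.e. Θ_Γ(Sp)(Sv_1,…,Sv_{n+3t}) = (−1)^{(n+3t)/2} Θ_Γ(p)(v_1,…,v_{n+3t}) for all p ∈ U and tangent vectors v_1,…,v_{n+3t}.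 (Combined with the behaviour of the induced orientation of S_{n,t} under S, this yields that the anomaly coefficient f_Γ = ∫_{S_{n,t}} Θ_Γ vanishes whenever Γ is primitive of even degree (n+t)/2.) -/
/- STATEMENT 15: the involution `S(a, η, ω) = (-a, η, -ω)` preserves the domain
of `Θ_Γ` and the variety `S_{n,t}`, and pulls `Θ_Γ` back to
`(-1)^{(n+3t)/2} Θ_Γ` (whence `f_Γ = 0` for primitive graphs of even degree). -/

noncomputable section

/-- the linear involution `S(a, η₁,…,η_n, ω₁,…,ω_t) = (-a, η, -ω)`. -/
def Sinv {n t : ℕ} (p : WS n t) : WS n t := (-p.1, p.2.1, fun j => -(p.2.2 j))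

theorem Sinv_involutive (n t : ℕ) : Function.Involutive (Sinv : WS n t → WS n t) := by
  intro p
  simp [Sinv]

theorem dot3_neg_neg (a b : V3) : dot3 (-a) (-b) = dot3 a b := by
  simp [dot3]

theorem gauss2_neg (x a b : V3) : gauss2 (-x) (-a) (-b) = -gauss2 x a b := by
  rw [gauss2, dot3_neg_neg, gauss2, ← neg_div]
  congr 1
  simp [dot3, cross3]
  ring

theorem posS_Sinv {n t : ℕ} (p : WS n t) (u : Fin n ⊕ Fin t) :
    posS (Sinv p) u = -posS p u := by
  cases u <;> simp [posS, Sinv]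

theorem dposS_Sinv {n t : ℕ} (p w : WS n t) (u : Fin n ⊕ Fin t) :
    dposS (Sinv p) (Sinv w) u = -dposS p w u := by
  cases u <;> simp [dposS, Sinv, add_comm]

theorem Sinv_mem_UTheta {n t : ℕ} (Γ : Tri n t) {p : WS n t} (hp : p ∈ UTheta Γ) :
    Sinv p ∈ UTheta Γ := by
  intro e
  simpa [posS_Sinv] using hp e

theorem Sinv_mem_Snt {n t : ℕ} {p : WS n t} (hp : p ∈ Snt n t) : Sinv p ∈ Snt n t := by
  obtain ⟨ha, hη, hω, hd, hn, hc⟩ := hp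
  refine ⟨?_, hη, fun i j hij => hω (neg_injective hij), fun i j => ?_, ?_, ?_⟩
  · simpa [Sinv, dot3_neg_neg] using ha
  · simpa [Sinv] using hd i j
  · simpa [Sinv, dot3_neg_neg] using hn
  · simpa [Sinv, dot3_neg_neg] using hc

/-- An involution mapping a set into itself maps it onto itself. -/
theorem Function.Involutive.image_eq_of_mapsTo {α : Type*} {f : α → α}
    (hf : Function.Involutive f) {s : Set α} (h : Set.MapsTo f s s) : f '' s = s :=
  h.image_subset.antisymm fun x hx => ⟨f x, h hx, hf x⟩

/-- A trivalent diagram has `(n + 3t)/2` non-Wilson edges. -/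
theorem two_mul_card_edges {n t : ℕ} (Γ : Tri n t) :
    2 * Fintype.card Γ.E = n + 3 * t := by
  have h := Fintype.card_congr Γ.anch
  rw [Fintype.card_prod, Fintype.card_bool, Fintype.card_sigma, Fintype.sum_sum_type] at h
  simp only [Fintype.card_fin] at h
  simp only [triBound, Finset.sum_const, Finset.card_univ, Fintype.card_fin, smul_eq_mul] at h
  omega

theorem ThetaEval_Sinv {n t : ℕ} (Γ : Tri n t) (p : WS n t)
    (v : ((u : Fin n ⊕ Fin t) × Fin (triBound n t u)) → WS n t) :
    ThetaEval Γ (Sinv p) (fun γ => Sinv (v γ)) =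
      (-1 : ℝ) ^ Fintype.card Γ.E * ThetaEval Γ p v := by
  unfold ThetaEval
  simp only [posS_Sinv, dposS_Sinv, neg_sub_neg, ← neg_sub (posS p (Γ.ep _ true)),
    ← neg_sub (dposS p _ (Γ.ep _ true)), gauss2_neg, Finset.prod_neg, Finset.card_univ,
    Finset.mul_sum]
  exact Finset.sum_congr rfl fun τ _ => by ring

theorem theta_pullback_involution (n t m : ℕ) (Γ : Tri n t)
    (hm : n + 3 * t = 2 * m) :
    (Sinv '' (UTheta Γ) = UTheta Γ ∧ Sinv '' (Snt n t) = Snt n t) ∧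
    (∀ p ∈ UTheta Γ,
      ∀ v : ((u : Fin n ⊕ Fin t) × Fin (triBound n t u)) → WS n t,
        ThetaEval Γ (Sinv p) (fun γ => Sinv (v γ)) =
          (-1 : ℝ) ^ m * ThetaEval Γ p v) := by
  refine ⟨⟨(Sinv_involutive n t).image_eq_of_mapsTo fun _ => Sinv_mem_UTheta Γ,
    (Sinv_involutive n t).image_eq_of_mapsTo fun _ => Sinv_mem_Snt⟩, fun p _ v => ?_⟩
  have hcard := two_mul_card_edges Γ
  rw [ThetaEval_Sinv, show Fintype.card Γ.E = m by omega]

end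
end

section
/- Let n₁, n₂ ≥ 0 and, for m ≥ 0, let Δ_m = { t ∈ ℝ^m : 0 < t_1 < … < t_m < 1 } be the open m-simplex. Let f be Lebesgue-integrable on Δ_{n₁} and g Lebesgue-integrable on Δ_{n₂}. Then (∫_{Δ_{n₁}} f)(∫_{Δ_{n₂}} g) = Σ_σ ∫_{Δ_{n₁+n₂}} f(t_{σ(1)},…,t_{σ(n₁)}) · g(t_{σ(n₁+1)},…,t_{σ(n₁+n₂)}) dt, where the sum is over all (n₁,n₂)-shuffles σ, i.e. permutations σ of {1,…,n₁+n₂} with σ(1) < … < σ(n₁) and σ(n₁+1) < … < σ(n₁+n₂). -/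
/- STATEMENT 16: the shuffle decomposition of iterated integrals:
`(∫_{Δ_{n₁}} f)(∫_{Δ_{n₂}} g) = Σ_σ ∫_{Δ_{n₁+n₂}} f(t_{σ(1)},…,t_{σ(n₁)}) ·
g(t_{σ(n₁+1)},…,t_{σ(n₁+n₂)}) dt`, the sum being over all `(n₁,n₂)`-shuffles. -/

open MeasureTheory

attribute [local instance] Classical.propDecidable

/-- the open `m`-simplex `{0 < t₁ < … < t_m < 1}`. -/
def openSimplex (m : ℕ) : Set (Fin m → ℝ) :=
  {s | (∀ i j : Fin m, i < j → s i < s j) ∧ ∀ i : Fin m, 0 < s i ∧ s i < 1}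

/-- `(n₁, n₂)`-shuffles: permutations of `{1, …, n₁+n₂}` increasing on the first
`n₁` and on the last `n₂` letters. -/
def IsShuffle (n₁ n₂ : ℕ) (σ : Equiv.Perm (Fin (n₁ + n₂))) : Prop :=
  (∀ i j : Fin n₁, i < j → σ (Fin.castAdd n₂ i) < σ (Fin.castAdd n₂ j)) ∧
  (∀ i j : Fin n₂, i < j → σ (Fin.natAdd n₁ i) < σ (Fin.natAdd n₁ j))

theorem measurableSet_openSimplex (m : ℕ) : MeasurableSet (openSimplex m) := by
  unfold openSimplex
  measurability

/-- Reindexing coordinates along an equivalence preserves Lebesgue measure. -/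
theorem measurePreserving_comp_equiv {ι κ : Type*} [Fintype ι] [Fintype κ] (e : ι ≃ κ) :
    MeasurePreserving (fun (w : κ → ℝ) i => w (e i)) :=
  (volume_measurePreserving_piCongrLeft (fun _ : κ => ℝ) e).symm

theorem measurableEmbedding_comp_equiv {ι κ : Type*} (e : ι ≃ κ) :
    MeasurableEmbedding (fun (w : κ → ℝ) i => w (e i)) :=
  (MeasurableEquiv.piCongrLeft (fun _ : κ => ℝ) e).symm.measurableEmbedding

/-- Splitting off the first `n₁` and the last `n₂` coordinates preserves Lebesgue measure. -/
theorem measurePreserving_splitCoords (n₁ n₂ : ℕ) :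
    MeasurePreserving (fun w : Fin (n₁ + n₂) → ℝ =>
      ((fun i => w (Fin.castAdd n₂ i), fun i => w (Fin.natAdd n₁ i)) :
        (Fin n₁ → ℝ) × (Fin n₂ → ℝ))) :=
  (volume_measurePreserving_sumPiEquivProdPi (fun _ : Fin n₁ ⊕ Fin n₂ => ℝ)).comp
    (measurePreserving_comp_equiv finSumFinEquiv)

theorem measurableEmbedding_splitCoords (n₁ n₂ : ℕ) :
    MeasurableEmbedding (fun w : Fin (n₁ + n₂) → ℝ =>
      ((fun i => w (Fin.castAdd n₂ i), fun i => w (Fin.natAdd n₁ i)) :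
        (Fin n₁ → ℝ) × (Fin n₂ → ℝ))) :=
  (MeasurableEquiv.sumPiEquivProdPi (fun _ : Fin n₁ ⊕ Fin n₂ => ℝ)).measurableEmbedding.comp
    (measurableEmbedding_comp_equiv finSumFinEquiv)

/-- Almost every point has pairwise distinct coordinates. -/
theorem ae_injective_coords (ι : Type*) [Fintype ι] :
    ∀ᵐ w : ι → ℝ, Function.Injective w := by
  have h : ∀ i j : ι, i ≠ j → ∀ᵐ w : ι → ℝ, w i ≠ w j := by
    intro i j hij
    let s : Submodule ℝ (ι → ℝ) :=
      LinearMap.ker (LinearMap.proj (R := ℝ) (φ := fun _ : ι => ℝ) i - LinearMap.proj j)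
    have hs : s ≠ ⊤ := by
      intro hs
      have hmem : (Pi.single i 1 : ι → ℝ) ∈ s := hs ▸ Submodule.mem_top
      simp [s, hij.symm] at hmem
    refine measure_mono_null (fun w hw => ?_) (Measure.addHaar_submodule volume s hs)
    simpa [s, sub_eq_zero] using hw
  have h' : ∀ᵐ w : ι → ℝ, ∀ i j : ι, i ≠ j → w i ≠ w j :=
    ae_all_iff.2 fun i => ae_all_iff.2 fun j => ae_all_iff.2 (h i j)
  filter_upwards [h'] with w hw i j hij
  by_contra hne
  exact hw i j hne hij

/-- The chamber of points whose coordinates, reordered by `σ⁻¹`, lie in the open simplex. -/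
def simplexChamber {n : ℕ} (σ : Equiv.Perm (Fin n)) : Set (Fin n → ℝ) :=
  (fun w i => w (σ.symm i)) ⁻¹' openSimplex n

theorem measurableSet_simplexChamber {n : ℕ} (σ : Equiv.Perm (Fin n)) :
    MeasurableSet (simplexChamber σ) :=
  (measurePreserving_comp_equiv σ.symm).measurable (measurableSet_openSimplex n)

theorem lt_iff_of_mem_simplexChamber {n : ℕ} {σ : Equiv.Perm (Fin n)} {w : Fin n → ℝ}
    (hw : w ∈ simplexChamber σ) (i j : Fin n) : w i < w j ↔ σ i < σ j := by
  have hmono : StrictMono fun k => w (σ.symm k) := fun a b => hw.1 a b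
  simpa using hmono.lt_iff_lt (a := σ i) (b := σ j)

theorem pairwise_disjoint_simplexChamber (n : ℕ) :
    Pairwise (Function.onFun Disjoint (simplexChamber (n := n))) := by
  intro σ τ hne
  refine Set.disjoint_left.2 fun w hσ hτ => hne ?_
  have hσ' : StrictMono (w ∘ σ.symm) := fun a b => hσ.1 a b
  have hτ' : StrictMono (w ∘ τ.symm) := fun a b => hτ.1 a b
  have heq := Tuple.unique_monotone hσ'.monotone hτ'.monotone
  have hinj : Function.Injective w := (Equiv.injective_comp σ.symm w).1 hσ'.injective
  have hsymm : σ.symm = τ.symm := Equiv.ext fun i => hinj (congrFun heq i)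
  simpa using congrArg Equiv.symm hsymm

/-- Every point with distinct coordinates in `(0, 1)` lies in some chamber. -/
theorem exists_mem_simplexChamber {n : ℕ} {w : Fin n → ℝ} (hinj : Function.Injective w)
    (hw : ∀ i, 0 < w i ∧ w i < 1) : ∃ σ : Equiv.Perm (Fin n), w ∈ simplexChamber σ := by
  have hmono : StrictMono (w ∘ Tuple.sort w) :=
    (Tuple.monotone_sort w).strictMono_of_injective (hinj.comp (Tuple.sort w).injective)
  exact ⟨(Tuple.sort w).symm, fun _ _ hij => hmono hij, fun _ => hw _⟩

/-- The product of two open simplices, as a set of concatenated points. -/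
def simplexProduct (n₁ n₂ : ℕ) : Set (Fin (n₁ + n₂) → ℝ) :=
  (fun w => ((fun i => w (Fin.castAdd n₂ i), fun i => w (Fin.natAdd n₁ i)) :
    (Fin n₁ → ℝ) × (Fin n₂ → ℝ))) ⁻¹' (openSimplex n₁ ×ˢ openSimplex n₂)

theorem simplexChamber_subset_simplexProduct {n₁ n₂ : ℕ} {σ : Equiv.Perm (Fin (n₁ + n₂))}
    (hσ : IsShuffle n₁ n₂ σ) : simplexChamber σ ⊆ simplexProduct n₁ n₂ := by
  intro w hw
  have hbound : ∀ i, 0 < w i ∧ w i < 1 := fun i => by simpa using hw.2 (σ i)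
  exact ⟨⟨fun i j hij => (lt_iff_of_mem_simplexChamber hw _ _).2 (hσ.1 i j hij),
    fun i => hbound _⟩, ⟨fun i j hij => (lt_iff_of_mem_simplexChamber hw _ _).2 (hσ.2 i j hij),
    fun i => hbound _⟩⟩

/-- Up to a null set, the product of two simplices is the union of the shuffle chambers. -/
theorem simplexProduct_ae_eq_biUnion (n₁ n₂ : ℕ) :
    simplexProduct n₁ n₂ =ᵐ[volume]
      ⋃ σ ∈ Finset.univ.filter (IsShuffle n₁ n₂), simplexChamber σ := by
  filter_upwards [ae_injective_coords (Fin (n₁ + n₂))] with w hinj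
  refine propext ⟨fun hw => ?_, fun hw => ?_⟩
  · have hbound : ∀ i, 0 < w i ∧ w i < 1 :=
      fun i => Fin.addCases (fun i => hw.1.2 i) (fun i => hw.2.2 i) i
    obtain ⟨σ, hσ⟩ := exists_mem_simplexChamber hinj hbound
    have hshuffle : IsShuffle n₁ n₂ σ :=
      ⟨fun i j hij => (lt_iff_of_mem_simplexChamber hσ _ _).1 (hw.1.1 i j hij),
        fun i j hij => (lt_iff_of_mem_simplexChamber hσ _ _).1 (hw.2.1 i j hij)⟩
    exact Set.mem_biUnion (by simpa using hshuffle) hσ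
  · obtain ⟨σ, hσ, hwσ⟩ := Set.mem_iUnion₂.1 hw
    exact simplexChamber_subset_simplexProduct (by simpa using hσ) hwσ

/-- Change of variables from the chamber of `σ` to the open simplex. -/
theorem setIntegral_simplexChamber {n : ℕ} (σ : Equiv.Perm (Fin n)) (F : (Fin n → ℝ) → ℝ) :
    ∫ w in simplexChamber σ, F w = ∫ w in openSimplex n, F fun i => w (σ i) := by
  rw [← (measurePreserving_comp_equiv σ).setIntegral_preimage_emb
    (measurableEmbedding_comp_equiv σ) F (simplexChamber σ)]
  simp [simplexChamber, Set.preimage_preimage]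

theorem shuffle_decomposition_of_iterated_integrals
    (n₁ n₂ : ℕ) (f : (Fin n₁ → ℝ) → ℝ) (g : (Fin n₂ → ℝ) → ℝ)
    (hf : IntegrableOn f (openSimplex n₁))
    (hg : IntegrableOn g (openSimplex n₂)) :
    (∫ u in openSimplex n₁, f u) * (∫ v in openSimplex n₂, g v) =
      ∑ σ ∈ Finset.univ.filter (IsShuffle n₁ n₂),
        ∫ w in openSimplex (n₁ + n₂),
          f (fun i => w (σ (Fin.castAdd n₂ i))) *
            g (fun i => w (σ (Fin.natAdd n₁ i))) := by
  let F : (Fin (n₁ + n₂) → ℝ) → ℝ := fun w =>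
    f (fun i => w (Fin.castAdd n₂ i)) * g (fun i => w (Fin.natAdd n₁ i))
  have hprod : IntegrableOn (fun z : (Fin n₁ → ℝ) × (Fin n₂ → ℝ) => f z.1 * g z.2)
      (openSimplex n₁ ×ˢ openSimplex n₂) := by
    rw [IntegrableOn, Measure.volume_eq_prod, ← Measure.prod_restrict]
    exact Integrable.mul_prod hf hg
  have hF : IntegrableOn F (simplexProduct n₁ n₂) :=
    ((measurePreserving_splitCoords n₁ n₂).integrableOn_comp_preimage
      (measurableEmbedding_splitCoords n₁ n₂)).2 hprod
  calc (∫ u in openSimplex n₁, f u) * (∫ v in openSimplex n₂, g v)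
      = ∫ z in openSimplex n₁ ×ˢ openSimplex n₂, f z.1 * g z.2 :=
        (setIntegral_prod_mul f g _ _).symm
    _ = ∫ w in simplexProduct n₁ n₂, F w :=
        ((measurePreserving_splitCoords n₁ n₂).setIntegral_preimage_emb
          (measurableEmbedding_splitCoords n₁ n₂) (fun z => f z.1 * g z.2) _).symm
    _ = ∫ w in ⋃ σ ∈ Finset.univ.filter (IsShuffle n₁ n₂), simplexChamber σ, F w :=
        setIntegral_congr_set (simplexProduct_ae_eq_biUnion n₁ n₂)
    _ = ∑ σ ∈ Finset.univ.filter (IsShuffle n₁ n₂), ∫ w in simplexChamber σ, F w :=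
        integral_biUnion_finset _ (fun σ _ => measurableSet_simplexChamber σ)
          ((pairwise_disjoint_simplexChamber _).set_pairwise _)
          (fun σ hσ => hF.mono_set
            (simplexChamber_subset_simplexProduct (Finset.mem_filter.1 hσ).2))
    _ = _ := Finset.sum_congr rfl fun σ _ => setIntegral_simplexChamber σ F
end
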